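/- If p > 1, the optimization problem inf_{μ ∈ KRu(Z)} F(Aμ) + G_{α,β}(μ) admits a minimizer. -/

import Mathlib

open MeasureTheory Filter Topology
open scoped ENNReal NNReal

noncomputable section
attribute [local instance] Classical.propDecidable

variable {Z : Type*} [MetricSpace Z] [MeasurableSpace Z] [BorelSpace Z]

/-- Integral `∫ f dμ` of a function against a finite signed measure, via Jordan decomposition. -/
def sInteg (μ : SignedMeasure Z) (f : Z → ℝ) : ℝ :=
  (∫ z, f z ∂μ.toJordanDecomposition.posPart) - ∫ z, f z ∂μ.toJordanDecomposition.negPart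

/-- Total variation norm `‖μ‖_TV`. -/
def tvNorm (μ : SignedMeasure Z) : ℝ := (μ.totalVariation Set.univ).toReal

/-- The unbalanced Kantorovich–Rubinstein norm
`‖μ‖_KRu = |μ(Z)| + sup { ∫ f dμ : f(e) = 0, Lip(f) ≤ 1 }`. -/
def kruNorm (e : Z) (μ : SignedMeasure Z) : ℝ :=
  |μ Set.univ| +
    sSup {r : ℝ | ∃ f : Z → ℝ, f e = 0 ∧ LipschitzWith 1 f ∧ r = sInteg μ f}

/-- The balanced Kantorovich–Rubinstein norm `‖μ‖_KR = sup { ∫ f dμ : f(e) = 0, Lip(f) ≤ 1 }`. -/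
def krNorm (e : Z) (μ : SignedMeasure Z) : ℝ :=
  sSup {r : ℝ | ∃ f : Z → ℝ, f e = 0 ∧ LipschitzWith 1 f ∧ r = sInteg μ f}

/-- `μ ∈ M_1(Z)`: finite first moment, `∫ d(z,e) d|μ| < ∞`. -/
def MemM1 (e : Z) (μ : SignedMeasure Z) : Prop :=
  (∫⁻ z, ENNReal.ofReal (dist z e) ∂μ.totalVariation) < ⊤

/-- `μ ∈ M_p(Z)`: finite `p`-th moment, `∫ d(z,e)^p d|μ| < ∞`. -/
def MemMp (e : Z) (p : ℝ) (μ : SignedMeasure Z) : Prop :=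
  (∫⁻ z, ENNReal.ofReal (dist z e ^ p) ∂μ.totalVariation) < ⊤

/-- `∫ (1 + d(z,e)^p) d|μ|` as an extended nonnegative real number. -/
def momLint (e : Z) (p : ℝ) (μ : SignedMeasure Z) : ℝ≥0∞ :=
  ∫⁻ z, ENNReal.ofReal (1 + dist z e ^ p) ∂μ.totalVariation

/-- Dirac measure at a point, as a signed measure. -/
def diracSM (x : Z) : SignedMeasure Z := (Measure.dirac x).toSignedMeasure

/-- The regularizer `G_{α,β}(μ) = α‖μ‖_KRu + β ∫ (1 + d(z,e)^p) d|μ|` if `μ ∈ M_p(Z)`,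
and `+∞` otherwise, as an extended real number. -/
def Gab (e : Z) (p α β : ℝ) (μ : SignedMeasure Z) : EReal :=
  if MemMp e p μ then ((α * kruNorm e μ + β * (momLint e p μ).toReal : ℝ) : EReal) else ⊤

/-- A geodesic metric space: any two points are joined by points realizing all
intermediate distance proportions. -/
def IsGeodesic (Z : Type*) [MetricSpace Z] : Prop :=
  ∀ x y : Z, ∀ t : ℝ, 0 ≤ t → t ≤ 1 →
    ∃ z : Z, dist x z = t * dist x y ∧ dist z y = (1 - t) * dist x y

set_option linter.unusedSectionVars false

lemma geo_near (hgeo : IsGeodesic Z) (e x : Z) (s δ : ℝ) (hs : 0 ≤ s) (hδ : 0 ≤ δ)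
    (h : dist x e ≤ s + δ) : ∃ y : Z, dist y e ≤ s ∧ dist x y ≤ δ := by
  by_cases hx : dist x e ≤ s
  · exact ⟨x, hx, by simpa using hδ⟩
  push Not at hx
  have hd : 0 < dist e x := by rw [dist_comm]; linarith
  rw [dist_comm] at hx h
  obtain ⟨z, h1, h2⟩ := hgeo e x (s / dist e x) (by positivity) (by rw [div_le_one hd]; linarith)
  refine ⟨z, ?_, ?_⟩
  · rw [dist_comm, h1]; field_simp; rfl
  · rw [dist_comm, h2, sub_mul, div_mul_cancel₀ _ hd.ne']; linarith

lemma hopf_rinow [LocallyCompactSpace Z] [CompleteSpace Z] (hgeo : IsGeodesic Z) (e : Z) (r : ℝ) :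
    IsCompact (Metric.closedBall e r) := by
  by_contra hr
  set S : Set ℝ := {r | IsCompact (Metric.closedBall e r)} with hS
  have hmono : ∀ s ∈ S, ∀ t ≤ s, t ∈ S := fun s hs t hts =>
    IsCompact.of_isClosed_subset hs Metric.isClosed_closedBall (Metric.closedBall_subset_closedBall hts)
  have h0 : (0 : ℝ) ∈ S := by simp [hS]
  have hb : BddAbove S := ⟨r, fun s hs => by
    by_contra h
    exact hr (hmono s hs r (le_of_not_ge h))⟩
  have hR0 : 0 ≤ sSup S := le_csSup hb h0
  have hRc : IsCompact (Metric.closedBall e (sSup S)) := by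
    refine isCompact_iff_totallyBounded_isComplete.2 ⟨?_, Metric.isClosed_closedBall.isComplete⟩
    rw [Metric.totallyBounded_iff]
    intro ε hε
    obtain ⟨s, hsS, hs⟩ := exists_lt_of_lt_csSup ⟨0, h0⟩ (show sSup S - ε / 2 < sSup S by linarith)
    have hs' : max s 0 ∈ S := by rcases max_choice s 0 with h | h <;> rw [h] <;> assumption
    obtain ⟨t, ht, hcov⟩ := Metric.totallyBounded_iff.1 (IsCompact.totallyBounded hs') (ε / 2) (by linarith)
    refine ⟨t, ht, fun x hx => ?_⟩
    rw [Metric.mem_closedBall] at hx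
    obtain ⟨y, hy, hxy⟩ := geo_near hgeo e x (max s 0) (ε / 2) (le_max_right _ _) (by linarith)
      (by have := le_max_left s 0; linarith)
    have := hcov (Metric.mem_closedBall.2 hy)
    simp only [Set.mem_iUnion, Metric.mem_ball] at this ⊢
    obtain ⟨i, hi, hyi⟩ := this
    exact ⟨i, hi, by have := dist_triangle x y i; linarith⟩
  obtain ⟨δ, hδ, hc⟩ := hRc.exists_isCompact_cthickening
  have : sSup S + δ ∈ S := by
    refine IsCompact.of_isClosed_subset hc Metric.isClosed_closedBall fun x hx => ?_
    obtain ⟨y, hy, hxy⟩ := geo_near hgeo e x (sSup S) δ hR0 hδ.le hx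
    exact Metric.mem_cthickening_of_dist_le x y δ _ hy hxy
  have := le_csSup hb this
  linarith

lemma F_bdd {H : Type*} [NormedAddCommGroup H] [InnerProductSpace ℝ H]
    (F : H → EReal)
    (hFnebot : ∀ x, F x ≠ ⊥) (hFproper : ∃ x, F x ≠ ⊤)
    (hFconvex : ∀ x y : H, ∀ a b : ℝ, 0 ≤ a → 0 ≤ b → a + b = 1 →
      F (a • x + b • y) ≤ (a : EReal) * F x + (b : EReal) * F y)
    (hFcoercive : ∀ c : ℝ, ∃ R : ℝ, ∀ x : H, R ≤ ‖x‖ → (c : EReal) ≤ F x)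
    (hFlsc : LowerSemicontinuous F) : ∃ m : ℝ, ∀ x, (m : EReal) ≤ F x := by
  obtain ⟨x0, hx0⟩ := hFproper
  obtain ⟨v, hv⟩ : ∃ v : ℝ, F x0 = v := ⟨(F x0).toReal, (EReal.coe_toReal hx0 (hFnebot x0)).symm⟩
  obtain ⟨R, hR⟩ := hFcoercive 0
  have h1 := hFlsc x0 ((v - 1 : ℝ) : EReal) (by show _ < F x0; rw [hv]; exact_mod_cast (by linarith : v - 1 < v))
  obtain ⟨δ, hδ, hball⟩ := Metric.eventually_nhds_iff.1 h1
  refine ⟨min 0 (v - 1 - 2 * (|R| + ‖x0‖) / δ), fun x => ?_⟩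
  by_cases hxR : R ≤ ‖x‖
  · exact le_trans (by exact_mod_cast min_le_left _ _) (hR x hxR)
  refine le_trans (EReal.coe_le_coe_iff.2 (min_le_right _ _)) ?_
  push Not at hxR
  by_cases hxd : dist x x0 < δ
  · refine le_trans ?_ (hball hxd).le
    have : 0 ≤ 2 * (|R| + ‖x0‖) / δ := by positivity
    exact_mod_cast (by linarith)
  push Not at hxd
  by_cases htop : F x = ⊤
  · rw [htop]; exact le_top
  obtain ⟨u, hu⟩ : ∃ u : ℝ, F x = u := ⟨(F x).toReal, (EReal.coe_toReal htop (hFnebot x)).symm⟩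
  have hn : dist x x0 ≤ |R| + ‖x0‖ := by
    rw [dist_eq_norm]
    have := norm_sub_le x x0
    have := le_abs_self R
    linarith
  have hdpos : 0 < dist x x0 := by linarith
  set t := δ / (2 * dist x x0) with ht
  have ht0 : 0 < t := by positivity
  have ht1 : t ≤ 1 := by rw [ht, div_le_one (by positivity)]; linarith
  have hc := hFconvex x0 x (1 - t) t (by linarith) ht0.le (by ring)
  have hy : dist ((1 - t) • x0 + t • x) x0 < δ := by
    rw [dist_eq_norm, show (1 - t) • x0 + t • x - x0 = t • (x - x0) by module, norm_smul,
      ← dist_eq_norm, Real.norm_of_nonneg ht0.le, ht]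
    field_simp
    linarith
  have h2 := (hball hy).trans_le hc
  rw [hv, hu] at h2
  have h3 : v - 1 < (1 - t) * v + t * u := by exact_mod_cast h2
  rw [hu]
  refine EReal.coe_le_coe_iff.2 ?_
  have h4 : v - 1 / t < u := by
    have : t * (v - 1 / t) < t * u := by
      rw [mul_sub, mul_one_div_cancel ht0.ne']; linarith
    exact lt_of_mul_lt_mul_left this ht0.le
  have h5 : 1 / t = 2 * dist x x0 / δ := by rw [ht]; field_simp
  have h6 : 2 * dist x x0 / δ ≤ 2 * (|R| + ‖x0‖) / δ := by gcongr
  linarith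

/-- Weight integral of a measure. -/
def wInt (e : Z) (p : ℝ) (a : Measure Z) : ℝ≥0∞ := ∫⁻ z, ENNReal.ofReal (1 + dist z e ^ p) ∂a

lemma w_cont (e : Z) (p : ℝ) (hp : 1 < p) : Continuous fun z : Z => 1 + dist z e ^ p :=
  continuous_const.add ((continuous_id.dist continuous_const).rpow_const (fun _ => Or.inr (by linarith)))

lemma w_ge (e : Z) (p : ℝ) (hp : 1 < p) (z : Z) : dist z e ≤ 1 + dist z e ^ p := by
  rcases le_total 1 (dist z e) with h | h
  · have := Real.self_le_rpow_of_one_le h hp.le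
    linarith
  · have : 0 ≤ dist z e ^ p := by positivity
    linarith

lemma w_one_le (e : Z) (p : ℝ) (z : Z) : 1 ≤ 1 + dist z e ^ p := by
  have : 0 ≤ dist z e ^ p := by positivity
  linarith

lemma wInt_lsc (e : Z) (p : ℝ) (hp : 1 < p) :
    LowerSemicontinuous fun a : FiniteMeasure Z => wInt e p (a : Measure Z) := by
  let g : ℕ → BoundedContinuousFunction Z ℝ≥0 := fun n =>
    BoundedContinuousFunction.mkOfBound
      ⟨fun z => min (Real.toNNReal (1 + dist z e ^ p)) n,
        (continuous_real_toNNReal.comp (w_cont e p hp)).min continuous_const⟩ n (by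
        intro x y
        rw [NNReal.dist_eq, abs_le]
        have h1 : ((min (Real.toNNReal (1 + dist x e ^ p)) n : ℝ≥0) : ℝ) ≤ n := by
          exact_mod_cast min_le_right _ _
        have h2 : ((min (Real.toNNReal (1 + dist y e ^ p)) n : ℝ≥0) : ℝ) ≤ n := by
          exact_mod_cast min_le_right _ _
        have h3 := (min (Real.toNNReal (1 + dist x e ^ p)) n : ℝ≥0).coe_nonneg
        have h4 := (min (Real.toNNReal (1 + dist y e ^ p)) n : ℝ≥0).coe_nonneg
        simp only [ContinuousMap.coe_mk]
        constructor <;> linarith)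
  have heq : (fun a : FiniteMeasure Z => wInt e p (a : Measure Z)) =
      fun a : FiniteMeasure Z => ⨆ n, ((a.testAgainstNN (g n) : ℝ≥0) : ℝ≥0∞) := by
    ext a
    simp only [FiniteMeasure.testAgainstNN_coe_eq]
    rw [← lintegral_iSup]
    · unfold wInt
      congr 1
      ext z
      apply le_antisymm
      · obtain ⟨n, hn⟩ := exists_nat_ge (Real.toNNReal (1 + dist z e ^ p))
        refine le_iSup_of_le n ?_
        show ENNReal.ofReal _ ≤ ((min (Real.toNNReal (1 + dist z e ^ p)) n : ℝ≥0) : ℝ≥0∞)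
        rw [min_eq_left hn]; rfl
      · refine iSup_le fun n => ?_
        exact ENNReal.coe_le_coe.2 (min_le_left _ _)
    · intro n
      exact (measurable_coe_nnreal_ennreal.comp (g n).continuous.measurable)
    · intro n m hnm z
      refine ENNReal.coe_le_coe.2 (min_le_min le_rfl ?_)
      exact_mod_cast hnm
  rw [heq]
  refine lowerSemicontinuous_iSup fun n => Continuous.lowerSemicontinuous ?_
  exact ENNReal.continuous_coe.comp (FiniteMeasure.continuous_testAgainstNN_eval (g n))

/-- Sublevel of the weight integral. -/
def SS (e : Z) (p : ℝ) (c : ℝ≥0) : Set (FiniteMeasure Z) :=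
  {a | wInt e p (a : Measure Z) ≤ c}

lemma SS_compact [LocallyCompactSpace Z] [CompleteSpace Z] (hgeo : IsGeodesic Z) (e : Z)
    (p : ℝ) (hp : 1 < p) (c : ℝ≥0) : IsCompact (SS e p c) := by
  have hK := isCompact_setOfPred_finiteMeasure_mass_le_compl_isCompact_le (E := Z)
    (u := fun n : ℕ => c / (n + 1)) (K := fun n : ℕ => Metric.closedBall e ((n : ℝ) + 1)) c
    (by
      have := (tendsto_const_div_atTop_nhds_zero_nat (c : ℝ)).comp (tendsto_add_atTop_nat 1)
      rw [← NNReal.tendsto_coe]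
      simpa [Function.comp_def] using this)
    (fun n => hopf_rinow hgeo e _) (Or.inl inferInstance)
  refine hK.of_isClosed_subset ((wInt_lsc e p hp).isClosed_preimage c) fun a ha => ?_
  have ha : wInt e p (a : Measure Z) ≤ c := ha
  refine ⟨?_, fun n => ?_⟩
  · rw [← ENNReal.coe_le_coe, FiniteMeasure.ennreal_mass]
    refine le_trans ?_ ha
    rw [← lintegral_one]
    exact lintegral_mono fun z => by simpa using w_one_le e p z
  · rw [le_div_iff₀ (by positivity), ← ENNReal.coe_le_coe, ENNReal.coe_mul,
      FiniteMeasure.ennreal_coeFn_eq_coeFn_toMeasure, mul_comm]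
    refine le_trans ?_ ha
    refine le_trans ?_ (mul_meas_ge_le_lintegral (μ := (a : Measure Z))
      (w_cont e p hp).measurable.ennreal_ofReal (((n : ℝ≥0) + 1 : ℝ≥0) : ℝ≥0∞))
    gcongr
    intro z hz
    simp only [Set.mem_compl_iff, Metric.mem_closedBall, not_le] at hz
    have := w_ge e p hp z
    rw [Set.mem_ofPred_eq, ENNReal.le_ofReal_iff_toReal_le ENNReal.coe_ne_top (by positivity),
      ENNReal.coe_toReal]
    push_cast
    linarith

lemma exists_approx (e : Z) (p : ℝ) (hp : 1 < p) (hc : ∀ r, IsCompact (Metric.closedBall e r))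
    (η : ℝ) (hη : 0 < η) :
    ∃ (t : Finset Z) (φ : Z → BoundedContinuousFunction Z ℝ), ∀ f : Z → ℝ, f e = 0 →
      LipschitzWith 1 f → ∀ z, |f z - ∑ i ∈ t, f i * φ i z| ≤ η * (1 + dist z e ^ p) := by
  obtain ⟨R, hR0, hR⟩ : ∃ R : ℝ, 0 < R ∧ R ^ (-(p - 1)) ≤ η := by
    have h1 := (tendsto_rpow_neg_atTop (show 0 < p - 1 by linarith)).eventually (eventually_le_nhds hη)
    obtain ⟨R, h2, h3⟩ := (h1.and (eventually_gt_atTop 0)).exists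
    exact ⟨R, h3, h2⟩
  obtain ⟨t', ht', hcov⟩ := Metric.totallyBounded_iff.1 (hc R).totallyBounded (η / 2) (by linarith)
  set t := ht'.toFinset with ht
  let ψ : Z → Z → ℝ := fun i z => max 0 (1 - dist z i / η)
  have hψ0 : ∀ i z, 0 ≤ ψ i z := fun i z => le_max_left _ _
  have hψ1 : ∀ i z, ψ i z ≤ 1 := fun i z => max_le zero_le_one (by
    have : 0 ≤ dist z i / η := by positivity
    linarith)
  have hψc : ∀ i, Continuous (ψ i) := fun i => by fun_prop
  let D : Z → ℝ := fun z => max (∑ i ∈ t, ψ i z) (1 / 2)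
  have hD : ∀ z, 1 / 2 ≤ D z := fun z => le_max_right _ _
  have hDc : Continuous D := by
    have : Continuous fun z => ∑ i ∈ t, ψ i z := continuous_finsetSum _ fun i _ => hψc i
    exact this.max continuous_const
  have hD0 : ∀ z, 0 < D z := fun z => by have := hD z; linarith
  let φ : Z → BoundedContinuousFunction Z ℝ := fun i =>
    BoundedContinuousFunction.ofNormedAddCommGroup (fun z => ψ i z / D z)
      ((hψc i).div hDc (fun z => (hD0 z).ne')) 2 (fun z => by
        rw [Real.norm_of_nonneg (div_nonneg (hψ0 i z) (hD0 z).le), div_le_iff₀ (hD0 z)]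
        have := hD z; have := hψ1 i z; linarith)
  refine ⟨t, φ, fun f hf0 hf z => ?_⟩
  have hφ : ∀ i, φ i z = ψ i z / D z := fun i => rfl
  have hφ0 : ∀ i, 0 ≤ φ i z := fun i => by rw [hφ]; exact div_nonneg (hψ0 i z) (hD0 z).le
  have hw1 := w_one_le e p z
  have hlip : ∀ x y, |f x - f y| ≤ dist x y := fun x y => by
    have := hf.dist_le_mul x y
    rwa [Real.dist_eq, NNReal.coe_one, one_mul] at this
  have hfz : |f z| ≤ dist z e := by simpa [hf0] using hlip z e
  set s := ∑ i ∈ t, φ i z with hs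
  have hs' : s = (∑ i ∈ t, ψ i z) / D z := by rw [hs, Finset.sum_div]; exact Finset.sum_congr rfl fun i _ => hφ i
  have hs0 : 0 ≤ s := Finset.sum_nonneg fun i _ => hφ0 i
  have hs1 : s ≤ 1 := by rw [hs', div_le_one (hD0 z)]; exact le_max_left _ _
  have hdec : f z - ∑ i ∈ t, f i * φ i z = ∑ i ∈ t, φ i z * (f z - f i) + (1 - s) * f z := by
    have : ∑ i ∈ t, φ i z * (f z - f i) = s * f z - ∑ i ∈ t, f i * φ i z := by
      rw [hs, Finset.sum_mul, ← Finset.sum_sub_distrib]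
      exact Finset.sum_congr rfl fun i _ => by ring
    rw [this]; ring
  have h1 : |∑ i ∈ t, φ i z * (f z - f i)| ≤ s * η := by
    refine (Finset.abs_sum_le_sum_abs _ _).trans ?_
    rw [hs, Finset.sum_mul]
    refine Finset.sum_le_sum fun i _ => ?_
    rw [abs_mul, abs_of_nonneg (hφ0 i)]
    by_cases hd : dist z i ≤ η
    · exact mul_le_mul_of_nonneg_left ((hlip z i).trans hd) (hφ0 i)
    · have : ψ i z = 0 := max_eq_left (by
        have : 1 ≤ dist z i / η := by rw [le_div_iff₀ hη]; linarith
        linarith)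
      simp [hφ, this]
  rw [hdec]
  refine (abs_add_le _ _).trans ?_
  rw [abs_mul, abs_of_nonneg (show 0 ≤ 1 - s by linarith)]
  by_cases hz : dist z e ≤ R
  · have : s = 1 := by
      have hz' := hcov (Metric.mem_closedBall.2 hz)
      simp only [Set.mem_iUnion, Metric.mem_ball] at hz'
      obtain ⟨i, hi, hzi⟩ := hz'
      have h2 : 1 / 2 ≤ ψ i z := by
        refine le_trans ?_ (le_max_right _ _)
        have : dist z i / η ≤ 1 / 2 := by rw [div_le_iff₀ hη]; linarith
        linarith
      have h3 : ψ i z ≤ ∑ i ∈ t, ψ i z :=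
        Finset.single_le_sum (f := fun i => ψ i z) (fun i _ => hψ0 i z) (by simpa [ht] using hi)
      have h4 : D z = ∑ i ∈ t, ψ i z := max_eq_left (by linarith)
      rw [hs', h4, div_self]
      linarith
    rw [this] at h1 ⊢
    nlinarith
  · push Not at hz
    have hdp : 0 < dist z e := by linarith
    have h5 : dist z e ≤ η * dist z e ^ p := by
      have h6 : dist z e ^ (-(p - 1)) ≤ η :=
        (Real.rpow_le_rpow_of_nonpos hR0 hz.le (by linarith)).trans hR
      have h7 : dist z e ^ (-(p - 1)) * dist z e ^ p = dist z e := by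
        rw [← Real.rpow_add hdp]; simp
      calc dist z e = dist z e ^ (-(p - 1)) * dist z e ^ p := h7.symm
        _ ≤ _ := by gcongr
    have h8 : (1 - s) * |f z| ≤ dist z e := by nlinarith [abs_nonneg (f z)]
    nlinarith

lemma int_w (e : Z) (p : ℝ) (hp : 1 < p) (a : Measure Z) (h : wInt e p a ≠ ⊤) :
    Integrable (fun z => 1 + dist z e ^ p) a := by
  refine ⟨(w_cont e p hp).measurable.aestronglyMeasurable, ?_⟩
  rw [hasFiniteIntegral_iff_ofReal (ae_of_all _ fun z => zero_le_one.trans (w_one_le e p z))]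
  exact lt_top_iff_ne_top.2 h

lemma int_w_le (e : Z) (p : ℝ) (hp : 1 < p) (a : Measure Z) (c : ℝ≥0) (h : wInt e p a ≤ c) :
    ∫ z, (1 + dist z e ^ p) ∂a ≤ c := by
  rw [integral_eq_lintegral_of_nonneg_ae (ae_of_all _ fun z => zero_le_one.trans (w_one_le e p z))
    (w_cont e p hp).measurable.aestronglyMeasurable]
  exact ENNReal.toReal_le_coe_of_le_coe h

lemma lip_le {e : Z} {f : Z → ℝ} (hf0 : f e = 0) (hf : LipschitzWith 1 f) (z : Z) :
    |f z| ≤ dist z e := by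
  have := hf.dist_le_mul z e
  rwa [Real.dist_eq, NNReal.coe_one, one_mul, hf0, sub_zero] at this

lemma int_lip {e : Z} {p : ℝ} (hp : 1 < p) {a : Measure Z} (h : wInt e p a ≠ ⊤) {f : Z → ℝ}
    (hf0 : f e = 0) (hf : LipschitzWith 1 f) : Integrable f a :=
  (int_w e p hp a h).mono' hf.continuous.measurable.aestronglyMeasurable
    (ae_of_all _ fun z => (lip_le hf0 hf z).trans (w_ge e p hp z))

lemma key (e : Z) (p : ℝ) (hp : 1 < p) (hc : ∀ r, IsCompact (Metric.closedBall e r))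
    (c : ℝ≥0) (a0 : FiniteMeasure Z) (ha0 : a0 ∈ SS e p c) (ε : ℝ) (hε : 0 < ε) :
    ∀ᶠ a : FiniteMeasure Z in 𝓝[SS e p c] a0, ∀ f : Z → ℝ, f e = 0 → LipschitzWith 1 f →
      |∫ z, f z ∂(a : Measure Z) - ∫ z, f z ∂(a0 : Measure Z)| ≤ ε := by
  set η := ε / (4 * (c + 1)) with hη
  have hη0 : 0 < η := by positivity
  obtain ⟨t, φ, happ⟩ := exists_approx e p hp hc η hη0
  have hηc : η * c ≤ ε / 4 := by
    have : η * (c + 1) = ε / 4 := by rw [hη]; field_simp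
    nlinarith
  have hT : Tendsto (fun a : FiniteMeasure Z => ∑ i ∈ t, dist i e *
      |∫ z, φ i z ∂(a : Measure Z) - ∫ z, φ i z ∂(a0 : Measure Z)|) (𝓝 a0) (𝓝 0) := by
    have : (0 : ℝ) = ∑ i ∈ t, dist i e *
      |∫ z, φ i z ∂(a0 : Measure Z) - ∫ z, φ i z ∂(a0 : Measure Z)| := by simp
    rw [this]
    refine tendsto_finsetSum _ fun i _ => Tendsto.const_mul _ (Tendsto.abs (Tendsto.sub_const ?_ _))
    exact FiniteMeasure.tendsto_iff_forall_integral_tendsto.1 tendsto_id (φ i)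
  have hev := (hT.eventually (eventually_le_nhds (show (0 : ℝ) < ε / 2 by linarith))).filter_mono
    (nhdsWithin_le_nhds (s := SS e p c))
  filter_upwards [hev, self_mem_nhdsWithin] with a ha haS f hf0 hf
  have hfin : ∀ b ∈ SS e p c, wInt e p (b : Measure Z) ≠ ⊤ := fun b hb =>
    ne_top_of_le_ne_top ENNReal.coe_ne_top hb
  have hφi : ∀ (b : FiniteMeasure Z) i, Integrable (fun z => f i * φ i z) (b : Measure Z) :=
    fun b i => ((φ i).integrable _).const_mul _
  have herr : ∀ b ∈ SS e p c, |∫ z, f z ∂(b : Measure Z) - ∑ i ∈ t, f i * ∫ z, φ i z ∂(b : Measure Z)|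
      ≤ ε / 4 := by
    intro b hb
    have h1 : ∫ z, f z ∂(b : Measure Z) - ∑ i ∈ t, f i * ∫ z, φ i z ∂(b : Measure Z)
        = ∫ z, (f z - ∑ i ∈ t, f i * φ i z) ∂(b : Measure Z) := by
      rw [integral_sub (int_lip hp (hfin b hb) hf0 hf) (integrable_finsetSum _ fun i _ => hφi b i),
        integral_finsetSum _ fun i _ => hφi b i]
      simp only [integral_const_mul]
    rw [h1]
    have h2 := norm_integral_le_of_norm_le ((int_w e p hp _ (hfin b hb)).const_mul η)
      (f := fun z => f z - ∑ i ∈ t, f i * φ i z) (ae_of_all _ fun z => happ f hf0 hf z)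
    rw [Real.norm_eq_abs, integral_const_mul] at h2
    have h3 := int_w_le e p hp _ c hb
    nlinarith
  have e1 := herr a haS
  have e2 := herr a0 ha0
  have e3 : |∑ i ∈ t, f i * ∫ z, φ i z ∂(a : Measure Z) - ∑ i ∈ t, f i * ∫ z, φ i z ∂(a0 : Measure Z)|
      ≤ ε / 2 := by
    refine le_trans ?_ ha
    rw [← Finset.sum_sub_distrib]
    refine (Finset.abs_sum_le_sum_abs _ _).trans (Finset.sum_le_sum fun i _ => ?_)
    rw [← mul_sub, abs_mul]
    exact mul_le_mul_of_nonneg_right (lip_le hf0 hf i) (abs_nonneg _)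
  rw [abs_le] at *
  constructor <;> linarith

/-- Signed measure of a pair of finite measures. -/
def smd (a b : FiniteMeasure Z) : SignedMeasure Z :=
  (a : Measure Z).toSignedMeasure - (b : Measure Z).toSignedMeasure

lemma smd_pos (a b : FiniteMeasure Z) :
    (smd a b).toJordanDecomposition.posPart = (a : Measure Z) - (b : Measure Z) := by
  unfold smd
  rw [Measure.toJordanDecomposition_toSignedMeasure_sub,
    Measure.jordanDecompositionOfToSignedMeasureSub_posPart]

lemma smd_neg (a b : FiniteMeasure Z) :
    (smd a b).toJordanDecomposition.negPart = (b : Measure Z) - (a : Measure Z) := by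
  unfold smd
  rw [Measure.toJordanDecomposition_toSignedMeasure_sub,
    Measure.jordanDecompositionOfToSignedMeasureSub_negPart]

lemma smd_tv_le (a b : FiniteMeasure Z) :
    (smd a b).totalVariation ≤ (a : Measure Z) + (b : Measure Z) := by
  unfold SignedMeasure.totalVariation
  rw [smd_pos, smd_neg]
  exact add_le_add Measure.sub_le Measure.sub_le

lemma smd_sInteg (a b : FiniteMeasure Z) (f : Z → ℝ) (ha : Integrable f (a : Measure Z))
    (hb : Integrable f (b : Measure Z)) :
    sInteg (smd a b) f = ∫ z, f z ∂(a : Measure Z) - ∫ z, f z ∂(b : Measure Z) := by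
  unfold sInteg
  rw [smd_pos, smd_neg]
  have h1 : ((a : Measure Z) - (b : Measure Z)) + (b : Measure Z)
      = ((b : Measure Z) - (a : Measure Z)) + (a : Measure Z) := by
    rw [← Measure.toSignedMeasure_eq_toSignedMeasure_iff, Measure.toSignedMeasure_add,
      Measure.toSignedMeasure_add]
    have := Measure.sub_toSignedMeasure_eq_toSignedMeasure_sub (μ := (a : Measure Z)) (ν := (b : Measure Z))
    rw [sub_eq_sub_iff_add_eq_add] at this
    rw [← this, add_comm]
  have h2 : Integrable f ((a : Measure Z) - (b : Measure Z)) := ha.mono_measure Measure.sub_le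
  have h3 : Integrable f ((b : Measure Z) - (a : Measure Z)) := hb.mono_measure Measure.sub_le
  have h4 := congrArg (fun m => ∫ z, f z ∂m) h1
  simp only [integral_add_measure h2 hb, integral_add_measure h3 ha] at h4
  linarith

lemma smd_univ (a b : FiniteMeasure Z) :
    smd a b Set.univ = (a : Measure Z).real Set.univ - (b : Measure Z).real Set.univ := by
  unfold smd
  rw [Measure.toSignedMeasure_sub_apply MeasurableSet.univ]

lemma smd_sub (a b a0 b0 : FiniteMeasure Z) :
    smd a b + (-1 : ℝ) • smd a0 b0 = smd (a + b0) (b + a0) := by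
  unfold smd
  simp only [FiniteMeasure.toMeasure_add, Measure.toSignedMeasure_add]
  module

lemma kru_nonneg (e : Z) (μ : SignedMeasure Z) : 0 ≤ kruNorm e μ := by
  unfold kruNorm
  refine add_nonneg (abs_nonneg _) (Real.sSup_nonneg' ⟨0, ⟨fun _ => 0, rfl, ?_, ?_⟩, le_rfl⟩)
  · exact LipschitzWith.const' 0
  · simp [sInteg]

lemma kru_ne (e : Z) (μ : SignedMeasure Z) :
    {r : ℝ | ∃ f : Z → ℝ, f e = 0 ∧ LipschitzWith 1 f ∧ r = sInteg μ f}.Nonempty :=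
  ⟨_, fun _ => 0, rfl, LipschitzWith.const' 0, rfl⟩

lemma kru_bdd (e : Z) (p : ℝ) (hp : 1 < p) (a b : FiniteMeasure Z)
    (ha : wInt e p (a : Measure Z) ≠ ⊤) (hb : wInt e p (b : Measure Z) ≠ ⊤) :
    BddAbove {r : ℝ | ∃ f : Z → ℝ, f e = 0 ∧ LipschitzWith 1 f ∧ r = sInteg (smd a b) f} := by
  refine ⟨∫ z, (1 + dist z e ^ p) ∂(a : Measure Z) + ∫ z, (1 + dist z e ^ p) ∂(b : Measure Z), ?_⟩
  rintro r ⟨f, hf0, hf, rfl⟩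
  rw [smd_sInteg a b f (int_lip hp ha hf0 hf) (int_lip hp hb hf0 hf)]
  have h1 := norm_integral_le_of_norm_le (int_w e p hp _ ha) (f := f)
    (ae_of_all _ fun z => (lip_le hf0 hf z).trans (w_ge e p hp z))
  have h2 := norm_integral_le_of_norm_le (int_w e p hp _ hb) (f := f)
    (ae_of_all _ fun z => (lip_le hf0 hf z).trans (w_ge e p hp z))
  rw [Real.norm_eq_abs, abs_le] at h1 h2
  linarith

/-- Closeness of pairs. -/
def Close (e : Z) (ε : ℝ) (q q0 : FiniteMeasure Z × FiniteMeasure Z) : Prop :=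
  |(smd q.1 q.2) Set.univ - (smd q0.1 q0.2) Set.univ| ≤ ε ∧
  ∀ f : Z → ℝ, f e = 0 → LipschitzWith 1 f →
    |sInteg (smd q.1 q.2) f - sInteg (smd q0.1 q0.2) f| ≤ ε

lemma Close.symm {e : Z} {ε : ℝ} {q q0 : FiniteMeasure Z × FiniteMeasure Z} (h : Close e ε q q0) :
    Close e ε q0 q :=
  ⟨by rw [abs_sub_comm]; exact h.1, fun f hf0 hf => by rw [abs_sub_comm]; exact h.2 f hf0 hf⟩

lemma Close.kru_le {e : Z} {p : ℝ} (hp : 1 < p) {ε : ℝ} {q q0 : FiniteMeasure Z × FiniteMeasure Z}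
    (h : Close e ε q q0) (h1 : wInt e p (q0.1 : Measure Z) ≠ ⊤)
    (h2 : wInt e p (q0.2 : Measure Z) ≠ ⊤) :
    kruNorm e (smd q.1 q.2) ≤ kruNorm e (smd q0.1 q0.2) + 2 * ε := by
  have h3 : sSup {r : ℝ | ∃ f : Z → ℝ, f e = 0 ∧ LipschitzWith 1 f ∧ r = sInteg (smd q.1 q.2) f} ≤
      sSup {r : ℝ | ∃ f : Z → ℝ, f e = 0 ∧ LipschitzWith 1 f ∧ r = sInteg (smd q0.1 q0.2) f} + ε := by
    refine csSup_le (kru_ne e _) ?_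
    rintro r ⟨f, hf0, hf, rfl⟩
    have h4 := le_csSup (kru_bdd e p hp q0.1 q0.2 h1 h2) ⟨f, hf0, hf, rfl⟩
    have h5 := abs_le.1 (h.2 f hf0 hf)
    linarith
  have h6 := abs_sub_abs_le_abs_sub ((smd q.1 q.2) Set.univ) ((smd q0.1 q0.2) Set.univ)
  have h7 := h.1
  unfold kruNorm
  linarith

lemma wInt_add (e : Z) (p : ℝ) (a b : Measure Z) : wInt e p (a + b) = wInt e p a + wInt e p b := by
  unfold wInt
  rw [lintegral_add_measure]

lemma memM1_smd (e : Z) (p : ℝ) (hp : 1 < p) (a b : FiniteMeasure Z)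
    (ha : wInt e p (a : Measure Z) ≠ ⊤) (hb : wInt e p (b : Measure Z) ≠ ⊤) :
    MemM1 e (smd a b) := by
  unfold MemM1
  calc _ ≤ ∫⁻ z, ENNReal.ofReal (1 + dist z e ^ p) ∂((a : Measure Z) + (b : Measure Z)) :=
        lintegral_mono' (smd_tv_le a b) fun z => ENNReal.ofReal_le_ofReal (w_ge e p hp z)
    _ = wInt e p (a : Measure Z) + wInt e p (b : Measure Z) := wInt_add e p _ _
    _ < ⊤ := ENNReal.add_lt_top.2 ⟨lt_top_iff_ne_top.2 ha, lt_top_iff_ne_top.2 hb⟩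

lemma Close.kru_sub {e : Z} {p : ℝ} (hp : 1 < p) {ε : ℝ} {q q0 : FiniteMeasure Z × FiniteMeasure Z}
    (h : Close e ε q q0) (h1 : wInt e p (q0.1 : Measure Z) ≠ ⊤)
    (h2 : wInt e p (q0.2 : Measure Z) ≠ ⊤) (h3 : wInt e p (q.1 : Measure Z) ≠ ⊤)
    (h4 : wInt e p (q.2 : Measure Z) ≠ ⊤) :
    kruNorm e (smd (q.1 + q0.2) (q.2 + q0.1)) ≤ 2 * ε := by
  have e1 : |smd (q.1 + q0.2) (q.2 + q0.1) Set.univ| ≤ ε := by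
    rw [← smd_sub]
    have := h.1
    simpa [sub_eq_add_neg] using this
  have e2 : sSup {r : ℝ | ∃ f : Z → ℝ, f e = 0 ∧ LipschitzWith 1 f ∧
      r = sInteg (smd (q.1 + q0.2) (q.2 + q0.1)) f} ≤ ε := by
    refine csSup_le (kru_ne e _) ?_
    rintro r ⟨f, hf0, hf, rfl⟩
    have h5 := (abs_le.1 (h.2 f hf0 hf)).2
    have i1 := int_lip hp h1 hf0 hf
    have i2 := int_lip hp h2 hf0 hf
    have i3 := int_lip hp h3 hf0 hf
    have i4 := int_lip hp h4 hf0 hf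
    rw [smd_sInteg _ _ f i1 i2, smd_sInteg _ _ f i3 i4] at h5
    rw [smd_sInteg _ _ f (by rw [FiniteMeasure.toMeasure_add]; exact i3.add_measure i2)
      (by rw [FiniteMeasure.toMeasure_add]; exact i4.add_measure i1),
      FiniteMeasure.toMeasure_add, FiniteMeasure.toMeasure_add,
      integral_add_measure i3 i2, integral_add_measure i4 i1]
    linarith
  unfold kruNorm
  linarith

lemma SS_fin {e : Z} {p : ℝ} {c : ℝ≥0} {a : FiniteMeasure Z} (h : a ∈ SS e p c) :
    wInt e p (a : Measure Z) ≠ ⊤ := ne_top_of_le_ne_top ENNReal.coe_ne_top h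

lemma eventually_close (e : Z) (p : ℝ) (hp : 1 < p) (hc : ∀ r, IsCompact (Metric.closedBall e r))
    (c : ℝ≥0) (q0 : FiniteMeasure Z × FiniteMeasure Z) (hq0 : q0 ∈ SS e p c ×ˢ SS e p c)
    (ε : ℝ) (hε : 0 < ε) : ∀ᶠ q in 𝓝[SS e p c ×ˢ SS e p c] q0, Close e ε q q0 := by
  obtain ⟨a0, b0⟩ := q0
  have hm : ∀ a0 : FiniteMeasure Z, ∀ᶠ a : FiniteMeasure Z in 𝓝[SS e p c] a0,
      |(a : Measure Z).real Set.univ - (a0 : Measure Z).real Set.univ| ≤ ε / 2 := by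
    intro a0
    have h1 : Tendsto (fun a : FiniteMeasure Z =>
        |(a : Measure Z).real Set.univ - (a0 : Measure Z).real Set.univ|) (𝓝 a0) (𝓝 0) := by
      have h2 : Tendsto (fun a : FiniteMeasure Z => (a.mass : ℝ)) (𝓝 a0) (𝓝 a0.mass) :=
        (NNReal.continuous_coe.comp FiniteMeasure.continuous_mass).tendsto a0
      have h3 := (h2.sub_const (a0.mass : ℝ)).abs
      rw [sub_self, abs_zero] at h3
      exact h3
    exact (h1.eventually (eventually_le_nhds (show (0 : ℝ) < ε / 2 by linarith))).filter_mono
      nhdsWithin_le_nhds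
  have ka := (key e p hp hc c a0 hq0.1 (ε / 2) (by linarith)).and
    ((hm a0).and self_mem_nhdsWithin)
  have kb := (key e p hp hc c b0 hq0.2 (ε / 2) (by linarith)).and
    ((hm b0).and self_mem_nhdsWithin)
  rw [nhdsWithin_prod_eq]
  filter_upwards [ka.prod_mk kb] with q hq
  obtain ⟨⟨ha, ma, sa⟩, ⟨hb, mb, sb⟩⟩ := hq
  refine ⟨?_, fun f hf0 hf => ?_⟩
  · simp only [smd_univ]
    rw [abs_le] at *
    constructor <;> linarith
  · have ha := ha f hf0 hf
    have hb := hb f hf0 hf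
    simp only
    rw [smd_sInteg _ _ f (int_lip hp (SS_fin sa) hf0 hf) (int_lip hp (SS_fin sb) hf0 hf),
      smd_sInteg _ _ f (int_lip hp (SS_fin hq0.1) hf0 hf) (int_lip hp (SS_fin hq0.2) hf0 hf)]
    rw [abs_le] at *
    constructor <;> linarith

lemma kru_contOn (e : Z) (p : ℝ) (hp : 1 < p) (hc : ∀ r, IsCompact (Metric.closedBall e r))
    (c : ℝ≥0) : ContinuousOn (fun q : FiniteMeasure Z × FiniteMeasure Z => kruNorm e (smd q.1 q.2))
      (SS e p c ×ˢ SS e p c) := by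
  intro q0 hq0
  rw [ContinuousWithinAt, Metric.tendsto_nhds]
  intro ε hε
  filter_upwards [eventually_close e p hp hc c q0 hq0 (ε / 4) (by linarith), self_mem_nhdsWithin]
    with q hq hqS
  have h1 := hq.kru_le hp (SS_fin hq0.1) (SS_fin hq0.2)
  have h2 := hq.symm.kru_le hp (SS_fin hqS.1) (SS_fin hqS.2)
  rw [Real.dist_eq, abs_lt]
  constructor <;> linarith

lemma A_contOn (e : Z) (p : ℝ) (hp : 1 < p) (hc : ∀ r, IsCompact (Metric.closedBall e r))
    (c : ℝ≥0) {H : Type*} [NormedAddCommGroup H] [InnerProductSpace ℝ H]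
    (A : SignedMeasure Z → H)
    (hAadd : ∀ μ ν : SignedMeasure Z, A (μ + ν) = A μ + A ν)
    (hAsmul : ∀ (c : ℝ) (μ : SignedMeasure Z), A (c • μ) = c • A μ)
    (hAbdd : ∃ C : ℝ, ∀ μ : SignedMeasure Z, MemM1 e μ → ‖A μ‖ ≤ C * kruNorm e μ) :
    ContinuousOn (fun q : FiniteMeasure Z × FiniteMeasure Z => A (smd q.1 q.2))
      (SS e p c ×ˢ SS e p c) := by
  obtain ⟨C, hC⟩ := hAbdd
  intro q0 hq0
  rw [ContinuousWithinAt, Metric.tendsto_nhds]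
  intro ε hε
  have hpos : 0 < ε / (4 * (|C| + 1)) := by positivity
  filter_upwards [eventually_close e p hp hc c q0 hq0 _ hpos, self_mem_nhdsWithin]
    with q hq hqS
  have h1 := hq.kru_sub hp (SS_fin hq0.1) (SS_fin hq0.2) (SS_fin hqS.1) (SS_fin hqS.2)
  have hfin : ∀ a b : FiniteMeasure Z, a ∈ SS e p c → b ∈ SS e p c →
      wInt e p ((a + b : FiniteMeasure Z) : Measure Z) ≠ ⊤ := fun a b ha hb => by
    rw [FiniteMeasure.toMeasure_add, wInt_add]
    exact ENNReal.add_ne_top.2 ⟨SS_fin ha, SS_fin hb⟩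
  have h2 := hC _ (memM1_smd e p hp (q.1 + q0.2) (q.2 + q0.1) (hfin _ _ hqS.1 hq0.2)
    (hfin _ _ hqS.2 hq0.1))
  have h3 := kru_nonneg e (smd (q.1 + q0.2) (q.2 + q0.1))
  have h4 : A (smd (q.1 + q0.2) (q.2 + q0.1)) = A (smd q.1 q.2) - A (smd q0.1 q0.2) := by
    rw [← smd_sub, hAadd, hAsmul]; module
  rw [dist_eq_norm, ← h4]
  have h5 : (|C| + 1) * (ε / (4 * (|C| + 1))) = ε / 4 := by field_simp
  have h6 : C ≤ |C| + 1 := by linarith [le_abs_self C]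
  calc _ ≤ _ := h2
    _ ≤ (|C| + 1) * (2 * (ε / (4 * (|C| + 1)))) := mul_le_mul h6 h1 h3 (by positivity)
    _ = ε / 2 := by rw [mul_left_comm, h5]; ring
    _ < ε := by linarith

/-- The lifted regularizer on pairs of finite measures. -/
def JG (e : Z) (p α β : ℝ) (q : FiniteMeasure Z × FiniteMeasure Z) : EReal :=
  ((α * kruNorm e (smd q.1 q.2) : ℝ) : EReal) +
    ((ENNReal.ofReal β * (wInt e p (q.1 : Measure Z) + wInt e p (q.2 : Measure Z)) : ℝ≥0∞) : EReal)

lemma JG_eq (e : Z) (p α β : ℝ) (hβ : 0 < β) (q : FiniteMeasure Z × FiniteMeasure Z)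
    (h1 : wInt e p (q.1 : Measure Z) ≠ ⊤) (h2 : wInt e p (q.2 : Measure Z) ≠ ⊤) :
    JG e p α β q = ((α * kruNorm e (smd q.1 q.2) +
      β * (wInt e p (q.1 : Measure Z) + wInt e p (q.2 : Measure Z)).toReal : ℝ) : EReal) := by
  unfold JG
  rw [EReal.coe_add]
  congr 1
  rw [← EReal.coe_ennreal_toReal (ENNReal.mul_ne_top ENNReal.ofReal_ne_top
    (ENNReal.add_ne_top.2 ⟨h1, h2⟩)), ENNReal.toReal_mul, ENNReal.toReal_ofReal hβ.le]

lemma Gab_le_JG (e : Z) (p α β : ℝ) (hβ : 0 < β)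
    (q : FiniteMeasure Z × FiniteMeasure Z)
    (h1 : wInt e p (q.1 : Measure Z) ≠ ⊤) (h2 : wInt e p (q.2 : Measure Z) ≠ ⊤) :
    Gab e p α β (smd q.1 q.2) ≤ JG e p α β q := by
  have hW : wInt e p (q.1 : Measure Z) + wInt e p (q.2 : Measure Z) ≠ ⊤ :=
    ENNReal.add_ne_top.2 ⟨h1, h2⟩
  have hle : momLint e p (smd q.1 q.2) ≤ wInt e p (q.1 : Measure Z) + wInt e p (q.2 : Measure Z) := by
    rw [← wInt_add]
    exact lintegral_mono' (smd_tv_le _ _) le_rfl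
  have hmem : MemMp e p (smd q.1 q.2) := by
    refine lt_of_le_of_lt ?_ (lt_top_iff_ne_top.2 (ne_top_of_le_ne_top hW hle))
    exact lintegral_mono fun z => ENNReal.ofReal_le_ofReal (by linarith)
  rw [JG_eq e p α β hβ q h1 h2, Gab, if_pos hmem]
  refine EReal.coe_le_coe_iff.2 ?_
  have := ENNReal.toReal_mono hW hle
  have := mul_le_mul_of_nonneg_left this hβ.le
  linarith

/-- Jordan decomposition as a pair of finite measures. -/
def jd (μ : SignedMeasure Z) : FiniteMeasure Z × FiniteMeasure Z :=
  (⟨μ.toJordanDecomposition.posPart, inferInstance⟩, ⟨μ.toJordanDecomposition.negPart, inferInstance⟩)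

lemma smd_jd (μ : SignedMeasure Z) : smd (jd μ).1 (jd μ).2 = μ :=
  SignedMeasure.toSignedMeasure_toJordanDecomposition μ

lemma mom_jd (e : Z) (p : ℝ) (μ : SignedMeasure Z) :
    wInt e p ((jd μ).1 : Measure Z) + wInt e p ((jd μ).2 : Measure Z) = momLint e p μ := by
  rw [← wInt_add]; rfl

lemma mom_ne_top (e : Z) (p : ℝ) (μ : SignedMeasure Z) (h : MemMp e p μ) :
    momLint e p μ ≠ ⊤ := by
  unfold momLint
  have : ∀ z : Z, ENNReal.ofReal (1 + dist z e ^ p) = 1 + ENNReal.ofReal (dist z e ^ p) := fun z => by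
    rw [ENNReal.ofReal_add zero_le_one (by positivity), ENNReal.ofReal_one]
  simp only [this]
  rw [lintegral_add_left measurable_const, lintegral_one]
  refine ENNReal.add_ne_top.2 ⟨?_, h.ne⟩
  unfold SignedMeasure.totalVariation
  exact measure_ne_top _ _

lemma JG_jd (e : Z) (p α β : ℝ) (hβ : 0 < β) (μ : SignedMeasure Z) (h : MemMp e p μ) :
    JG e p α β (jd μ) = Gab e p α β μ := by
  have h1 := mom_ne_top e p μ h
  rw [← mom_jd, ENNReal.add_ne_top] at h1
  rw [JG_eq e p α β hβ _ h1.1 h1.2, Gab, if_pos h, mom_jd, smd_jd]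

lemma JG_lsc (e : Z) (p α β : ℝ) (hp : 1 < p) (hc : ∀ r, IsCompact (Metric.closedBall e r))
    (c : ℝ≥0) : LowerSemicontinuousOn (JG e p α β) (SS e p c ×ˢ SS e p c) := by
  unfold JG
  refine LowerSemicontinuousOn.add' ?_ ?_ ?_
  · refine ContinuousOn.lowerSemicontinuousOn ?_
    exact continuous_coe_real_ereal.comp_continuousOn
      (continuousOn_const.mul (kru_contOn e p hp hc c))
  · refine LowerSemicontinuous.lowerSemicontinuousOn ?_ _
    have h1 : LowerSemicontinuous fun q : FiniteMeasure Z × FiniteMeasure Z =>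
        wInt e p (q.1 : Measure Z) := (wInt_lsc e p hp).comp continuous_fst
    have h2 : LowerSemicontinuous fun q : FiniteMeasure Z × FiniteMeasure Z =>
        wInt e p (q.2 : Measure Z) := (wInt_lsc e p hp).comp continuous_snd
    have h3 : Continuous fun x : ℝ≥0∞ => ((ENNReal.ofReal β * x : ℝ≥0∞) : EReal) :=
      continuous_coe_ennreal_ereal.comp (ENNReal.continuous_const_mul ENNReal.ofReal_ne_top)
    exact h3.comp_lowerSemicontinuous (h1.add h2) (fun x y hxy => by
      exact EReal.coe_ennreal_le_coe_ennreal_iff.2 (mul_le_mul_right hxy _))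
  · intro q hq
    exact EReal.continuousAt_add (Or.inl (EReal.coe_ne_top _)) (Or.inl (EReal.coe_ne_bot _))

lemma Gab_nonneg (e : Z) (p α β : ℝ) (hα : 0 ≤ α) (hβ : 0 < β) (μ : SignedMeasure Z) :
    0 ≤ Gab e p α β μ := by
  unfold Gab
  split_ifs
  · have := kru_nonneg e μ
    exact_mod_cast (by positivity)
  · exact le_top

/-- If `p > 1`, the optimization problem
`inf_{μ ∈ KRu(Z)} F(Aμ) + G_{α,β}(μ)` admits a minimizer.  Here `A` is a continuous linear
operator from `KRu(Z)` to a Hilbert space `H` (encoded by linearity and `KRu`-boundedness on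
`M_1(Z)`), and `F : H → (−∞,+∞]` is proper, convex, coercive and lower semicontinuous.
Since `G_{α,β} = +∞` outside `M_p(Z)`, minimization over `KRu(Z)` reduces to minimization
over signed measures. -/
theorem exists_minimizer_Gab [LocallyCompactSpace Z] [CompleteSpace Z]
    [TopologicalSpace.SeparableSpace Z] (hgeo : IsGeodesic Z) (e : Z)
    (p α β : ℝ) (hp : 1 < p) (hα : 0 ≤ α) (hβ : 0 < β)
    {H : Type*} [NormedAddCommGroup H] [InnerProductSpace ℝ H] [CompleteSpace H]
    (A : SignedMeasure Z → H)
    (hAadd : ∀ μ ν : SignedMeasure Z, A (μ + ν) = A μ + A ν)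
    (hAsmul : ∀ (c : ℝ) (μ : SignedMeasure Z), A (c • μ) = c • A μ)
    (hAbdd : ∃ C : ℝ, ∀ μ : SignedMeasure Z, MemM1 e μ → ‖A μ‖ ≤ C * kruNorm e μ)
    (F : H → EReal)
    (hFnebot : ∀ x, F x ≠ ⊥) (hFproper : ∃ x, F x ≠ ⊤)
    (hFconvex : ∀ x y : H, ∀ a b : ℝ, 0 ≤ a → 0 ≤ b → a + b = 1 →
      F (a • x + b • y) ≤ (a : EReal) * F x + (b : EReal) * F y)
    (hFcoercive : ∀ c : ℝ, ∃ R : ℝ, ∀ x : H, R ≤ ‖x‖ → (c : EReal) ≤ F x)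
    (hFlsc : LowerSemicontinuous F) :
    ∃ μmin : SignedMeasure Z, ∀ μ : SignedMeasure Z,
      F (A μmin) + Gab e p α β μmin ≤ F (A μ) + Gab e p α β μ := by
  have hc := hopf_rinow hgeo e
  obtain ⟨m, hm⟩ := F_bdd F hFnebot hFproper hFconvex hFcoercive hFlsc
  by_cases hall : ∀ μ : SignedMeasure Z, F (A μ) + Gab e p α β μ = ⊤
  · exact ⟨0, fun μ => by rw [hall μ]; exact le_top⟩
  push Not at hall
  obtain ⟨μ0, hμ0⟩ := hall
  have hGnb : ∀ μ : SignedMeasure Z, Gab e p α β μ ≠ ⊥ := fun μ h => by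
    have := Gab_nonneg e p α β hα hβ μ
    rw [h] at this
    exact absurd this (by simp)
  obtain ⟨v, hv⟩ : ∃ v : ℝ, F (A μ0) + Gab e p α β μ0 = v :=
    ⟨_, (EReal.coe_toReal hμ0 (by simp [EReal.add_eq_bot_iff, hFnebot, hGnb])).symm⟩
  set c : ℝ≥0 := Real.toNNReal ((v - m) / β) with hcdef
  have hsub : ∀ μ : SignedMeasure Z, F (A μ) + Gab e p α β μ ≤ v →
      MemMp e p μ ∧ jd μ ∈ SS e p c ×ˢ SS e p c := by
    intro μ hμ
    have hmem : MemMp e p μ := by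
      by_contra hn
      rw [Gab, if_neg hn, EReal.add_top_of_ne_bot (hFnebot _)] at hμ
      exact absurd hμ (by simp)
    refine ⟨hmem, ?_⟩
    have h1 : (m : EReal) + Gab e p α β μ ≤ v := le_trans (by gcongr; exact hm _) hμ
    rw [Gab, if_pos hmem, ← EReal.coe_add, EReal.coe_le_coe_iff] at h1
    have h2 := mul_nonneg hα (kru_nonneg e μ)
    have h3 : (momLint e p μ).toReal ≤ (v - m) / β := by
      rw [le_div_iff₀ hβ]; linarith
    have h4 : momLint e p μ ≤ c := by
      rw [← ENNReal.ofReal_toReal (mom_ne_top e p μ hmem)]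
      exact ENNReal.ofReal_le_ofReal h3
    rw [← mom_jd] at h4
    exact ⟨le_self_add.trans h4, le_add_self.trans h4⟩
  have hcomp : IsCompact (SS e p c ×ˢ SS e p c) :=
    (SS_compact hgeo e p hp c).prod (SS_compact hgeo e p hp c)
  have hlsc : LowerSemicontinuousOn (fun q : FiniteMeasure Z × FiniteMeasure Z =>
      F (A (smd q.1 q.2)) + JG e p α β q) (SS e p c ×ˢ SS e p c) := by
    refine LowerSemicontinuousOn.add' ?_ (JG_lsc e p α β hp hc c) ?_
    · intro q hq y hy
      have hA := A_contOn e p hp hc c A hAadd hAsmul hAbdd q hq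
      exact hA.eventually (hFlsc (A (smd q.1 q.2)) y hy)
    · intro q hq
      rw [JG_eq e p α β hβ q (SS_fin hq.1) (SS_fin hq.2)]
      exact EReal.continuousAt_add (Or.inr (EReal.coe_ne_bot _)) (Or.inr (EReal.coe_ne_top _))
  have h0 := hsub μ0 hv.le
  obtain ⟨q, hq, hmin⟩ := hlsc.exists_isMinOn ⟨_, h0.2⟩ hcomp
  have hstep : ∀ μ : SignedMeasure Z, F (A μ) + Gab e p α β μ ≤ v →
      F (A (smd q.1 q.2)) + Gab e p α β (smd q.1 q.2) ≤ F (A μ) + Gab e p α β μ := by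
    intro μ hμ
    obtain ⟨hmem, hjd⟩ := hsub μ hμ
    have h1 := isMinOn_iff.1 hmin _ hjd
    rw [smd_jd, JG_jd e p α β hβ μ hmem] at h1
    refine le_trans ?_ h1
    gcongr
    exact Gab_le_JG e p α β hβ q (SS_fin hq.1) (SS_fin hq.2)
  refine ⟨smd q.1 q.2, fun μ => ?_⟩
  rcases le_total (F (A μ) + Gab e p α β μ) v with h | h
  · exact hstep μ h
  · exact ((hstep μ0 hv.le).trans hv.le).trans h
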